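/- arXiv:2601.18039 — 2 statements merged into one kernel-verified Lean document; each statement's English description precedes it below -/
import Mathlib

section
/- Let K be a field and let a₁, b₁, c₁, b₂, c₂, a₃, b₃, c₃, a₁′, a₃′, b₁′ be nonzero elements of K, and a₂ ∈ K arbitrary. Define c₁′ = a₁′c₂c₃/(a₃c₁), a₂′ = a₁a₃ + a₂b₁c₃, b₂′ = a₁b₃/a₃′, c₂′ = a₃c₁/a₁′, b₃′ = a₃′b₁b₂/(a₁b₃), c₃′ = b₃c₁/b₁′. Then, with A(a,b,c) = [[a,b],[c,0]], the 3×3 matrix equation A(a₁,b₁,c₁)₁ · A(a₂,b₂,c₂)₂ · A(a₃,b₃,c₃)₁ = A(a₁′,b₁′,c₁′)₂ · A(a₂′,b₂′,c₂′)₁ · A(a₃′,b₃′,c₃′)₂ holds. -/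
open Matrix

/-- Embedding of a `2 × 2` matrix into `3 × 3` acting on rows/columns 1 and 2. -/
def emb1 {R : Type*} [CommRing R] (M : Matrix (Fin 2) (Fin 2) R) : Matrix (Fin 3) (Fin 3) R :=
  !![M 0 0, M 0 1, 0; M 1 0, M 1 1, 0; 0, 0, 1]

/-- Embedding of a `2 × 2` matrix into `3 × 3` acting on rows/columns 2 and 3. -/
def emb2 {R : Type*} [CommRing R] (M : Matrix (Fin 2) (Fin 2) R) : Matrix (Fin 3) (Fin 3) R :=
  !![1, 0, 0; 0, M 0 0, M 0 1; 0, M 1 0, M 1 1]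

/-- The matrix `A(a,b,c) = [[a,b],[c,0]]`. -/
def Aabc {K : Type*} [Field K] (a b c : K) : Matrix (Fin 2) (Fin 2) K :=
  !![a, b; c, 0]

/-- Explicit parametrization of the `R`-correspondence with free parameters
`a₁′, a₃′, b₁′`. -/
theorem rCorrespondence_parametrization {K : Type*} [Field K]
    (a₁ b₁ c₁ b₂ c₂ a₃ b₃ c₃ a₁' a₃' b₁' : K) (a₂ : K)
    (ha₁ : a₁ ≠ 0) (hb₁ : b₁ ≠ 0) (hc₁ : c₁ ≠ 0) (hb₂ : b₂ ≠ 0) (hc₂ : c₂ ≠ 0)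
    (ha₃ : a₃ ≠ 0) (hb₃ : b₃ ≠ 0) (hc₃ : c₃ ≠ 0)
    (ha₁' : a₁' ≠ 0) (ha₃' : a₃' ≠ 0) (hb₁' : b₁' ≠ 0) :
    emb1 (Aabc a₁ b₁ c₁) * emb2 (Aabc a₂ b₂ c₂) * emb1 (Aabc a₃ b₃ c₃) =
      emb2 (Aabc a₁' b₁' (a₁' * c₂ * c₃ / (a₃ * c₁))) *
        emb1 (Aabc (a₁ * a₃ + a₂ * b₁ * c₃) (a₁ * b₃ / a₃') (a₃ * c₁ / a₁')) *
        emb2 (Aabc a₃' (a₃' * b₁ * b₂ / (a₁ * b₃)) (b₃ * c₁ / b₁')) := by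
  ext i j
  fin_cases i <;> fin_cases j <;>
    simp [emb1, emb2, Aabc, Matrix.mul_apply, Fin.sum_univ_three, mul_comm b₁ a₂] <;> field_simp
end

section
/- Let R be a commutative ring. Define ρ : R³ → R³ by ρ(x,y,z) = (z, xz + y, x). For 1 ≤ k ≤ 4 let R(k) : R⁶ → R⁶ apply ρ to the entries (t_k, t_{k+1}, t_{k+2}) of a 6-tuple t, leaving the remaining entries unchanged; for 1 ≤ k ≤ 5 let L(k) swap the entries t_k and t_{k+1}. Then L(3)∘R(1)∘R(3)∘L(5)∘L(2)∘R(3)∘R(1) = R(4)∘R(2)∘L(1)∘L(4)∘R(2)∘R(4)∘L(3) as maps R⁶ → R⁶, and both send (a₁, a₂, a₃, a₄, a₅, a₆) to (a₆, a₃a₆ + a₅, a₁a₃a₆ + a₂a₆ + a₁a₅ + a₄, a₃, a₁a₃ + a₂, a₁). -/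
/-- The very small `R`-matrix `ρ(x,y,z) = (z, xz + y, x)`. -/
def smallR {R : Type*} [CommRing R] (p : R × R × R) : R × R × R :=
  (p.2.2, p.1 * p.2.2 + p.2.1, p.1)

/-- `R(k)`: apply `ρ` to the entries in positions `k, k+1, k+2` (0-based `k`) of a 6-tuple. -/
def Rmv {R : Type*} [CommRing R] (k : Fin 6) (t : Fin 6 → R) : Fin 6 → R :=
  fun m =>
    if m = k then (smallR (t k, t (k + 1), t (k + 2))).1
    else if m = k + 1 then (smallR (t k, t (k + 1), t (k + 2))).2.1
    else if m = k + 2 then (smallR (t k, t (k + 1), t (k + 2))).2.2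
    else t m

/-- `L(k)`: swap the entries in positions `k` and `k+1` (0-based `k`). -/
def Lmv {R : Type*} [CommRing R] (k : Fin 6) (t : Fin 6 → R) : Fin 6 → R :=
  fun m => if m = k then t (k + 1) else if m = k + 1 then t k else t m

theorem Rmv_zero_vec {R : Type*} [CommRing R] (a b c d e f : R) :
    Rmv 0 ![a, b, c, d, e, f] = ![c, a * c + b, a, d, e, f] := by
  ext m; fin_cases m <;> rfl

theorem Rmv_one_vec {R : Type*} [CommRing R] (a b c d e f : R) :
    Rmv 1 ![a, b, c, d, e, f] = ![a, d, b * d + c, b, e, f] := by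
  ext m; fin_cases m <;> rfl

theorem Rmv_two_vec {R : Type*} [CommRing R] (a b c d e f : R) :
    Rmv 2 ![a, b, c, d, e, f] = ![a, b, e, c * e + d, c, f] := by
  ext m; fin_cases m <;> rfl

theorem Rmv_three_vec {R : Type*} [CommRing R] (a b c d e f : R) :
    Rmv 3 ![a, b, c, d, e, f] = ![a, b, c, f, d * f + e, d] := by
  ext m; fin_cases m <;> rfl

theorem Lmv_zero_vec {R : Type*} [CommRing R] (a b c d e f : R) :
    Lmv 0 ![a, b, c, d, e, f] = ![b, a, c, d, e, f] := by
  ext m; fin_cases m <;> rfl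

theorem Lmv_one_vec {R : Type*} [CommRing R] (a b c d e f : R) :
    Lmv 1 ![a, b, c, d, e, f] = ![a, c, b, d, e, f] := by
  ext m; fin_cases m <;> rfl

theorem Lmv_two_vec {R : Type*} [CommRing R] (a b c d e f : R) :
    Lmv 2 ![a, b, c, d, e, f] = ![a, b, d, c, e, f] := by
  ext m; fin_cases m <;> rfl

theorem Lmv_three_vec {R : Type*} [CommRing R] (a b c d e f : R) :
    Lmv 3 ![a, b, c, d, e, f] = ![a, b, c, e, d, f] := by
  ext m; fin_cases m <;> rfl

theorem Lmv_four_vec {R : Type*} [CommRing R] (a b c d e f : R) :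
    Lmv 4 ![a, b, c, d, e, f] = ![a, b, c, d, f, e] := by
  ext m; fin_cases m <;> rfl

/-- The tetrahedron (sonnet) equation for the very small `R`-matrix:
`L(3)R(1)R(3)L(5)L(2)R(3)R(1) = R(4)R(2)L(1)L(4)R(2)R(4)L(3)` as maps `R⁶ → R⁶`,
and both send `(a₁,…,a₆)` to
`(a₆, a₃a₆+a₅, a₁a₃a₆+a₂a₆+a₁a₅+a₄, a₃, a₁a₃+a₂, a₁)`.
(Moves are written with 0-based positions.) -/
theorem sonnet_very_small_R {R : Type*} [CommRing R] :
    (∀ t : Fin 6 → R,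
      Lmv 2 (Rmv 0 (Rmv 2 (Lmv 4 (Lmv 1 (Rmv 2 (Rmv 0 t)))))) =
        Rmv 3 (Rmv 1 (Lmv 0 (Lmv 3 (Rmv 1 (Rmv 3 (Lmv 2 t))))))) ∧
    (∀ a₁ a₂ a₃ a₄ a₅ a₆ : R,
      Lmv 2 (Rmv 0 (Rmv 2 (Lmv 4 (Lmv 1 (Rmv 2 (Rmv 0 ![a₁, a₂, a₃, a₄, a₅, a₆])))))) =
        ![a₆, a₃ * a₆ + a₅, a₁ * a₃ * a₆ + a₂ * a₆ + a₁ * a₅ + a₄, a₃,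
          a₁ * a₃ + a₂, a₁]) := by
  constructor
  · intro t
    have ht : t = ![t 0, t 1, t 2, t 3, t 4, t 5] := by
      ext m; fin_cases m <;> rfl
    rw [ht]
    simp only [Rmv_zero_vec, Rmv_one_vec, Rmv_two_vec, Rmv_three_vec, Lmv_zero_vec,
      Lmv_one_vec, Lmv_two_vec, Lmv_three_vec, Lmv_four_vec]
    congr! 3
    ring_nf
  · intro a₁ a₂ a₃ a₄ a₅ a₆
    simp only [Rmv_zero_vec, Rmv_two_vec, Lmv_one_vec, Lmv_two_vec, Lmv_four_vec]
    congr! 3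
    ring_nf
end
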